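/- Let (a_k) be the partial quotient sequence of e (a_0 = 2; for j ≥ 1: a_{3j-2}=1, a_{3j-1}=2j, a_{3j}=1), and let s_k/t_k be the corresponding convergents. Then for all k ≥ 0 with t_k odd: t_{k+24} is odd and the Jacobi symbols satisfy (s_k/t_k) = (s_{k+24}/t_{k+24}); moreover t_k is even if and only if t_{k+24} is even. That is, the Jacobi sequence of e is purely periodic with period length 24. -/

import Mathlib

/-- Numerators of continued fraction convergents: `cfS a k = s_k`
(with `s_{-1} = 1`, `s_0 = a_0`, `s_k = a_k s_{k-1} + s_{k-2}`). -/
def cfS (a : ℕ → ℤ) : ℕ → ℤ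
  | 0 => a 0
  | 1 => a 1 * a 0 + 1
  | (k+2) => a (k+2) * cfS a (k+1) + cfS a k

/-- Denominators of continued fraction convergents: `cfT a k = t_k`
(with `t_{-1} = 0`, `t_0 = 1`, `t_k = a_k t_{k-1} + t_{k-2}`). -/
def cfT (a : ℕ → ℤ) : ℕ → ℤ
  | 0 => 1
  | 1 => a 1
  | (k+2) => a (k+2) * cfT a (k+1) + cfT a k

/-- Partial quotients of Euler's number `e = [2, {1, 2j, 1}_{j=1}^∞]`:
`a 0 = 2`, and for `j ≥ 1`: `a (3j-2) = 1`, `a (3j-1) = 2j`, `a (3j) = 1`. -/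
def eCF : ℕ → ℤ := fun n =>
  if n = 0 then 2
  else if n % 3 = 1 then 1
  else if n % 3 = 0 then 1
  else 2 * (((n : ℤ) + 1) / 3)

/-- The Jacobi symbol of a fraction, given as the pair of its numerator and denominator. -/
def fracJacobi (x : ℤ × ℕ) : ℤ := jacobiSym x.1 x.2

/-- The determinant of the `2 × 2` matrix with columns `x` and `y`. -/
def fracDet (x y : ℤ × ℕ) : ℤ := x.1 * y.2 - y.1 * x.2

/-- The product of the Jacobi symbols of two fractions of determinant `δ = ± 1` with odd
denominators `m` and `n`, see `fracJacobi_mul`. -/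
def adjacentSign (δ : ℤ) (m n : ℕ) : ℤ := jacobiSym δ m * jacobiSym (-δ) n * qrSign m n

theorem fracDet_add_left (x y : ℤ × ℕ) : fracDet (x + y) y = fracDet x y := by
  simp only [fracDet, Prod.fst_add, Prod.snd_add]; push_cast; ring

theorem fracDet_add_right (x y : ℤ × ℕ) : fracDet x (y + x) = fracDet x y := by
  simp only [fracDet, Prod.fst_add, Prod.snd_add]; push_cast; ring

theorem fracDet_swap (x y : ℤ × ℕ) : fracDet y x = -fracDet x y := by
  simp only [fracDet]; ring

theorem jacobiSym_congr_of_isUnit {δ : ℤ} (hδ : IsUnit δ) {m n : ℕ} (hm : Odd m)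
    (h : m ≡ n [MOD 4]) : jacobiSym δ m = jacobiSym δ n := by
  have hn : Odd n := by
    rw [Nat.odd_iff] at hm ⊢
    have : m % 4 = n % 4 := h
    lia
  rcases Int.isUnit_iff.1 hδ with rfl | rfl
  · simp
  · rw [jacobiSym.at_neg_one hm, jacobiSym.at_neg_one hn,
      (ZMod.natCast_eq_natCast_iff m n 4).2 h]

theorem isUnit_χ₄_of_odd {m : ℕ} (hm : Odd m) : IsUnit (ZMod.χ₄ m) := by
  rw [ZMod.χ₄_eq_neg_one_pow (Nat.odd_iff.1 hm)]
  exact (isUnit_one.neg).pow _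

theorem adjacentSign_congr {δ : ℤ} (hδ : IsUnit δ) {m n m' n' : ℕ} (hm : Odd m) (hn : Odd n)
    (h : m ≡ m' [MOD 4]) (h' : n ≡ n' [MOD 4]) :
    adjacentSign δ m n = adjacentSign δ m' n' := by
  have hχ : ZMod.χ₄ m = ZMod.χ₄ m' := by rw [(ZMod.natCast_eq_natCast_iff m m' 4).2 h]
  rw [adjacentSign, adjacentSign, qrSign, qrSign, ← hχ, jacobiSym_congr_of_isUnit hδ hm h,
    jacobiSym_congr_of_isUnit hδ.neg hn h',
    jacobiSym_congr_of_isUnit (isUnit_χ₄_of_odd hm) hn h']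

theorem fracJacobi_sq {x y : ℤ × ℕ} (h : IsUnit (fracDet x y)) : fracJacobi x ^ 2 = 1 := by
  apply jacobiSym.sq_one
  rw [← Int.isCoprime_iff_gcd_eq_one]
  obtain ⟨c, hc⟩ := h.exists_left_inv
  exact ⟨c * y.2, -c * y.1, by rw [← hc, fracDet]; ring⟩

/-- Fractions with odd denominators and determinant `± 1` have Jacobi symbols whose product
is determined by the denominators modulo `4`. -/
theorem fracJacobi_mul {x y : ℤ × ℕ} (h : IsUnit (fracDet x y)) (hx : Odd x.2) (hy : Odd y.2) :
    fracJacobi x * fracJacobi y = adjacentSign (fracDet x y) x.2 y.2 := by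
  have h₁ : jacobiSym x.1 x.2 * jacobiSym y.2 x.2 = jacobiSym (fracDet x y) x.2 := by
    rw [← jacobiSym.mul_left]
    exact jacobiSym.mod_left' (Int.modEq_iff_dvd.2 ⟨-y.1, by rw [fracDet]; ring⟩)
  have h₂ : jacobiSym y.1 y.2 * jacobiSym x.2 y.2 = jacobiSym (-fracDet x y) y.2 := by
    rw [← jacobiSym.mul_left]
    exact jacobiSym.mod_left' (Int.modEq_iff_dvd.2 ⟨-x.1, by rw [fracDet]; ring⟩)
  have hs : jacobiSym (x.2 : ℤ) y.2 ^ 2 = 1 := by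
    apply jacobiSym.sq_one
    rw [← Int.isCoprime_iff_gcd_eq_one]
    obtain ⟨c, hc⟩ := h.exists_left_inv
    exact ⟨-c * y.1, c * x.1, by rw [← hc, fracDet]; ring⟩
  have hr := jacobiSym.quadratic_reciprocity' hy hx
  have hs' : jacobiSym (y.2 : ℤ) x.2 ^ 2 = 1 := by
    rw [hr, mul_pow, qrSign.sq_eq_one hx hy, hs, one_mul]
  rw [adjacentSign, ← h₁, ← h₂, fracJacobi, fracJacobi]
  have : jacobiSym (y.2 : ℤ) x.2 * jacobiSym (x.2 : ℤ) y.2 * qrSign x.2 y.2 = 1 := by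
    linear_combination hs' - jacobiSym (y.2 : ℤ) x.2 * hr
  linear_combination -(jacobiSym x.1 x.2 * jacobiSym y.1 y.2) * this

/-- The bases `(x, y)` and `(u, v)` have the same determinant `± 1`, denominators that agree
modulo `4`, and the same Jacobi symbols wherever the denominators are odd. -/
structure JacobiEquiv (x y u v : ℤ × ℕ) : Prop where
  isUnit : IsUnit (fracDet x y)
  det_eq : fracDet x y = fracDet u v
  modEq_left : x.2 ≡ u.2 [MOD 4]
  modEq_right : y.2 ≡ v.2 [MOD 4]
  jacobi_left : Odd x.2 → fracJacobi x = fracJacobi u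
  jacobi_right : Odd y.2 → fracJacobi y = fracJacobi v

theorem odd_iff_of_modEq_four {m n : ℕ} (h : m ≡ n [MOD 4]) : Odd m ↔ Odd n := by
  have : m % 4 = n % 4 := h
  rw [Nat.odd_iff, Nat.odd_iff]
  lia

/-- The Jacobi symbol of a fraction adjacent to a given one is determined modulo `4`. -/
theorem fracJacobi_eq_of_adjacent {x y u v : ℤ × ℕ} (h : IsUnit (fracDet x y))
    (hd : fracDet x y = fracDet u v) (hxu : x.2 ≡ u.2 [MOD 4]) (hyv : y.2 ≡ v.2 [MOD 4])
    (hx : Odd x.2) (hy : Odd y.2) (hj : fracJacobi y = fracJacobi v) :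
    fracJacobi x = fracJacobi u := by
  have h₁ := fracJacobi_mul h hx hy
  have h₂ := fracJacobi_mul (hd ▸ h) ((odd_iff_of_modEq_four hxu).1 hx)
    ((odd_iff_of_modEq_four hyv).1 hy)
  rw [← hd, ← adjacentSign_congr h hx hy hxu hyv, ← h₁, ← hj] at h₂
  have hs : fracJacobi y ^ 2 = 1 := fracJacobi_sq (y := x) (by rw [fracDet_swap]; exact h.neg)
  linear_combination -fracJacobi y * h₂ + (fracJacobi u - fracJacobi x) * hs

namespace JacobiEquiv

variable {x y u v p q : ℤ × ℕ}

theorem refl (h : IsUnit (fracDet x y)) : JacobiEquiv x y x y :=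
  ⟨h, rfl, rfl, rfl, fun _ ↦ rfl, fun _ ↦ rfl⟩

theorem symm (h : JacobiEquiv x y u v) : JacobiEquiv u v x y :=
  ⟨h.det_eq ▸ h.isUnit, h.det_eq.symm, h.modEq_left.symm, h.modEq_right.symm,
    fun ho ↦ (h.jacobi_left ((odd_iff_of_modEq_four h.modEq_left).2 ho)).symm,
    fun ho ↦ (h.jacobi_right ((odd_iff_of_modEq_four h.modEq_right).2 ho)).symm⟩

theorem trans (h : JacobiEquiv x y u v) (h' : JacobiEquiv u v p q) : JacobiEquiv x y p q :=
  ⟨h.isUnit, h.det_eq.trans h'.det_eq, h.modEq_left.trans h'.modEq_left,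
    h.modEq_right.trans h'.modEq_right,
    fun ho ↦ (h.jacobi_left ho).trans
      (h'.jacobi_left ((odd_iff_of_modEq_four h.modEq_left).1 ho)),
    fun ho ↦ (h.jacobi_right ho).trans
      (h'.jacobi_right ((odd_iff_of_modEq_four h.modEq_right).1 ho))⟩

theorem swap (h : JacobiEquiv x y u v) : JacobiEquiv y x v u :=
  ⟨by rw [fracDet_swap]; exact h.isUnit.neg, by rw [fracDet_swap x, fracDet_swap u, h.det_eq],
    h.modEq_right, h.modEq_left, h.jacobi_right, h.jacobi_left⟩

theorem add_left (h : JacobiEquiv x y u v) : JacobiEquiv (x + y) y (u + v) v where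
  isUnit := by rw [fracDet_add_left]; exact h.isUnit
  det_eq := by rw [fracDet_add_left, fracDet_add_left, h.det_eq]
  modEq_left := h.modEq_left.add h.modEq_right
  modEq_right := h.modEq_right
  jacobi_right := h.jacobi_right
  jacobi_left ho := by
    by_cases hy : Odd y.2
    · refine fracJacobi_eq_of_adjacent (y := y) (v := v) ?_ ?_
        (h.modEq_left.add h.modEq_right) h.modEq_right ho hy (h.jacobi_right hy)
      · rw [fracDet_add_left]; exact h.isUnit
      · rw [fracDet_add_left, fracDet_add_left, h.det_eq]
    · have hx : Odd x.2 := by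
        rw [Prod.snd_add, Nat.odd_add] at ho
        exact ho.2 (Nat.not_odd_iff_even.1 hy)
      have hd (a b : ℤ × ℕ) : fracDet (a + b) a = -fracDet a b := by
        rw [fracDet_swap, add_comm, fracDet_add_right]
      refine fracJacobi_eq_of_adjacent (y := x) (v := u) ?_ ?_
        (h.modEq_left.add h.modEq_right) h.modEq_left ho hx (h.jacobi_left hx)
      · rw [hd]; exact h.isUnit.neg
      · rw [hd, hd, h.det_eq]

theorem add_nsmul_left (h : JacobiEquiv x y u v) (n : ℕ) :
    JacobiEquiv (x + n • y) y (u + n • v) v := by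
  induction n with
  | zero => simpa using h
  | succ n ih => simpa only [succ_nsmul, add_assoc] using ih.add_left

theorem add_four_nsmul (h : IsUnit (fracDet x y)) : JacobiEquiv x y (x + 4 • y) y := by
  have hadd (z : ℤ × ℕ) : fracDet (z + y) z = fracDet y z := by
    rw [add_comm, fracDet_add_left]
  have hright (z : ℤ × ℕ) : fracDet y (z + y) = fracDet y z := fracDet_add_right y z
  have hyx : IsUnit (fracDet y x) := by rw [fracDet_swap]; exact h.neg
  have hdet : fracDet x y = fracDet (x + 4 • y) y := by
    rw [fracDet, fracDet, Prod.fst_add, Prod.snd_add, Prod.smul_fst, Prod.smul_snd, smul_eq_mul,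
      nsmul_eq_mul]
    push_cast
    ring
  have hmod : x.2 ≡ (x + 4 • y).2 [MOD 4] := by
    simp [Nat.ModEq]
  refine ⟨h, hdet, hmod, rfl, fun hx ↦ ?_, fun _ ↦ rfl⟩
  by_cases hy : Odd y.2
  · exact fracJacobi_eq_of_adjacent h hdet hmod rfl hx hy rfl
  rw [Nat.not_odd_iff_even] at hy
  have two_steps (z : ℤ × ℕ) (hz : Odd z.2) (hd : fracDet y z = fracDet y x) :
      fracJacobi (z + y + y) * fracJacobi z =
        adjacentSign (fracDet y x) z.2 (z.2 + y.2) *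
          adjacentSign (fracDet y x) (z.2 + y.2) z.2 := by
    have hzy : Odd (z + y).2 := hz.add_even hy
    have hzyy : Odd (z + y + y).2 := hzy.add_even hy
    have hm : (z + y + y).2 ≡ z.2 [MOD 4] := by
      obtain ⟨c, hc⟩ := hy
      simp only [Prod.snd_add, hc, Nat.ModEq]
      lia
    have hu₁ : fracDet (z + y) z = fracDet y x := by rw [hadd, hd]
    have hu₂ : fracDet (z + y + y) (z + y) = fracDet y x := by rw [hadd, hright, hd]
    have h₁ := fracJacobi_mul (hu₁ ▸ hyx) hzy hz
    have h₂ := fracJacobi_mul (hu₂ ▸ hyx) hzyy hzy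
    have hs : fracJacobi (z + y) ^ 2 = 1 := fracJacobi_sq (hu₁ ▸ hyx)
    rw [hu₁] at h₁
    rw [hu₂, adjacentSign_congr hyx hzyy hzy hm rfl] at h₂
    rw [Prod.snd_add] at h₁ h₂
    rw [← h₁, ← h₂]
    linear_combination -(fracJacobi (z + y + y) * fracJacobi z) * hs
  have hx₂ : Odd (x + y + y).2 := (hx.add_even hy).add_even hy
  have hm : (x + y + y).2 ≡ x.2 [MOD 4] := by
    obtain ⟨c, hc⟩ := hy
    simp only [Prod.snd_add, hc, Nat.ModEq]
    lia
  have h₁ := two_steps x hx rfl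
  have h₂ := two_steps (x + y + y) hx₂ (by rw [hright, hright])
  rw [adjacentSign_congr hyx hx₂ (hx₂.add_even hy) hm (hm.add_right _),
    adjacentSign_congr hyx (hx₂.add_even hy) hx₂ (hm.add_right _) hm, ← h₁] at h₂
  have hs : fracJacobi (x + y + y) ^ 2 = 1 := by
    apply fracJacobi_sq (y := y)
    rw [fracDet_add_left, fracDet_add_left]
    exact h
  have h4 : x + 4 • y = x + y + y + y + y := by
    rw [show (4 : ℕ) = 1 + 1 + 1 + 1 from rfl]
    simp only [add_nsmul, one_nsmul, add_assoc]
  rw [h4]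
  linear_combination -fracJacobi (x + y + y) * h₂ +
    (fracJacobi (x + y + y + y + y) - fracJacobi x) * hs

theorem add_mul_four_nsmul (h : IsUnit (fracDet x y)) (n : ℕ) :
    JacobiEquiv x y (x + (4 * n) • y) y := by
  induction n with
  | zero => simpa using refl h
  | succ n ih =>
    simpa only [mul_add, mul_one, add_nsmul, add_assoc] using
      ih.trans (add_four_nsmul ih.symm.isUnit)

theorem add_nsmul_mod (h : IsUnit (fracDet x y)) (n : ℕ) :
    JacobiEquiv (x + (n % 4) • y) y (x + n • y) y := by
  have := add_mul_four_nsmul ((refl h).add_nsmul_left (n % 4)).isUnit (n / 4)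
  rwa [add_assoc, ← add_nsmul, Nat.mod_add_div] at this

theorem append (h : JacobiEquiv x y u v) {m n : ℕ} (hmn : m ≡ n [MOD 4]) :
    JacobiEquiv y (x + m • y) v (u + n • v) := by
  have h₁ := add_nsmul_mod h.isUnit m
  have h₂ := h.add_nsmul_left (m % 4)
  have h₃ := add_nsmul_mod h.symm.isUnit n
  rw [← show m % 4 = n % 4 from hmn] at h₃
  exact (h₁.symm.trans (h₂.trans h₃)).swap

end JacobiEquiv

/-- Convergents as pairs, for nonnegative partial quotients. -/
def convergentPair (a : ℕ → ℤ) (k : ℕ) : ℤ × ℕ := (cfS a k, (cfT a k).natAbs)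

theorem cfT_nonneg {a : ℕ → ℤ} (ha : ∀ k, 0 ≤ a k) (k : ℕ) : 0 ≤ cfT a k := by
  induction k using Nat.twoStepInduction with
  | zero => simp [cfT]
  | one => exact ha 1
  | more k h₀ h₁ => exact add_nonneg (mul_nonneg (ha _) h₁) h₀

theorem convergentPair_add_two {a : ℕ → ℤ} (ha : ∀ k, 0 ≤ a k) (k : ℕ) :
    convergentPair a (k + 2) =
      convergentPair a k + (a (k + 2)).natAbs • convergentPair a (k + 1) := by
  have h₀ := cfT_nonneg ha k
  have h₁ := cfT_nonneg ha (k + 1)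
  have h₂ := mul_nonneg (ha (k + 2)) h₁
  ext
  · simp [convergentPair, cfS, abs_of_nonneg (ha (k + 2)), add_comm]
  · simp [convergentPair, cfT, add_comm _ (cfT a k), Int.natAbs_add_of_nonneg h₀ h₂,
      Int.natAbs_mul]

theorem eCF_nonneg (k : ℕ) : 0 ≤ eCF k := by
  unfold eCF
  split_ifs <;> lia

theorem eCF_add_24_modEq (k : ℕ) :
    (eCF (k + 1)).natAbs ≡ (eCF (k + 1 + 24)).natAbs [MOD 4] := by
  simp only [eCF, Nat.ModEq]
  split_ifs <;> lia

theorem jacobiEquiv_convergentPair_eCF (k : ℕ) :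
    JacobiEquiv (convergentPair eCF k) (convergentPair eCF (k + 1))
      (convergentPair eCF (k + 24)) (convergentPair eCF (k + 1 + 24)) := by
  induction k with
  | zero =>
    have h₀ : convergentPair eCF 0 = (2, 1) := by norm_num [convergentPair, cfS, cfT, eCF]
    have h₁ : convergentPair eCF 1 = (3, 1) := by norm_num [convergentPair, cfS, cfT, eCF]
    have h₂₄ : convergentPair eCF 24 = (14862109042, 5467464369) := by
      norm_num [convergentPair, cfS, cfT, eCF]
    have h₂₅ : convergentPair eCF 25 = (28875761731, 10622799089) := by
      norm_num [convergentPair, cfS, cfT, eCF]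
    rw [zero_add, zero_add, h₀, h₁, h₂₄, h₂₅]
    constructor <;> norm_num [fracDet, fracJacobi, Nat.ModEq]
  | succ k ih =>
    have := ih.append (eCF_add_24_modEq (k + 1))
    rw [convergentPair_add_two eCF_nonneg k]
    rw [show k + 1 + 1 + 24 = k + 24 + 2 by lia, convergentPair_add_two eCF_nonneg (k + 24)]
    exact this

theorem jacobi_sequence_of_e_purely_periodic_24 :
    ∀ k : ℕ,
      (Odd (cfT eCF k) → Odd (cfT eCF (k + 24)) ∧
        jacobiSym (cfS eCF k) (cfT eCF k).natAbs
          = jacobiSym (cfS eCF (k + 24)) (cfT eCF (k + 24)).natAbs) ∧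
      (Even (cfT eCF k) ↔ Even (cfT eCF (k + 24))) := by
  intro k
  have h := jacobiEquiv_convergentPair_eCF k
  have ho : Odd (cfT eCF k) ↔ Odd (cfT eCF (k + 24)) := by
    rw [← Int.natAbs_odd, ← Int.natAbs_odd]
    exact odd_iff_of_modEq_four h.modEq_left
  refine ⟨fun hk ↦ ⟨ho.1 hk, h.jacobi_left (Int.natAbs_odd.2 hk)⟩, ?_⟩
  rw [← Int.not_odd_iff_even, ← Int.not_odd_iff_even, ho]
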